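/- arXiv:1901.09531 — 5 statements merged into one kernel-verified Lean document; each statement's English description precedes it below -/
import Mathlib

section
/- Let C be an N × K real matrix, Q an N × K real matrix with orthonormal columns (QᵀQ = I_K) whose column space equals the column space of C, and P = I_N − QQᵀ. Suppose y, x ∈ ℝ^N, β ∈ ℝ, γ ∈ ℝ^K, and ε ∈ ℝ^N satisfy y = xβ + Cγ + ε with Cᵀε = 0 and x·ε = 0 (i.e., ε is the OLS residual of regressing y on x and C). Then Py = (Px)β + ε and (Px)·ε = 0, so that β and ε are also the OLS coefficient and residual of regressing Py on Px. -/
open Matrix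

/-- Projecting out the permanent covariates: if `y = xβ + Cγ + ε` is the OLS fit
(`ε` orthogonal to `x` and the columns of `C`), and `P = I − QQᵀ` projects onto
the orthogonal complement of the column space of `C`, then `Py = (Px)β + ε`
with `(Px)·ε = 0`. -/
theorem projection_trick {N K : ℕ} (C Q : Matrix (Fin N) (Fin K) ℝ)
    (hQ : Qᵀ * Q = 1)
    (hspan : LinearMap.range C.mulVecLin = LinearMap.range Q.mulVecLin)
    (P : Matrix (Fin N) (Fin N) ℝ) (hP : P = 1 - Q * Qᵀ)
    (y x : Fin N → ℝ) (β : ℝ) (γ : Fin K → ℝ) (ε : Fin N → ℝ)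
    (hmodel : y = β • x + C.mulVec γ + ε)
    (hCε : Cᵀ.mulVec ε = 0) (hxε : x ⬝ᵥ ε = 0) :
    P.mulVec y = β • P.mulVec x + ε ∧ (P.mulVec x) ⬝ᵥ ε = 0 := by
  have hQε : Qᵀ *ᵥ ε = 0 := by
    apply dotProduct_eq_zero
    intro w
    have hw : Q *ᵥ w ∈ LinearMap.range C.mulVecLin := by
      rw [hspan]; exact ⟨w, rfl⟩
    obtain ⟨v, hv⟩ := hw
    have hv' : C *ᵥ v = Q *ᵥ w := hv
    rw [mulVec_transpose, ← dotProduct_mulVec, ← hv', dotProduct_mulVec,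
      ← mulVec_transpose, hCε, zero_dotProduct]
  have hPε : P *ᵥ ε = ε := by
    rw [hP, sub_mulVec, one_mulVec, ← mulVec_mulVec, hQε, mulVec_zero, sub_zero]
  have hPC : P *ᵥ (C *ᵥ γ) = 0 := by
    have hw : C *ᵥ γ ∈ LinearMap.range Q.mulVecLin := by
      rw [← hspan]; exact ⟨γ, rfl⟩
    obtain ⟨v, hv⟩ := hw
    have hv' : Q *ᵥ v = C *ᵥ γ := hv
    rw [← hv', hP, mulVec_mulVec, Matrix.sub_mul, Matrix.mul_assoc, hQ, Matrix.one_mul,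
      Matrix.mul_one, sub_self, zero_mulVec]
  refine ⟨?_, ?_⟩
  · rw [hmodel, mulVec_add, mulVec_add, hPC, hPε, mulVec_smul, add_zero]
  · have hPt : Pᵀ = P := by
      rw [hP]; simp
    rw [dotProduct_comm, dotProduct_mulVec, ← mulVec_transpose, hPt, hPε, dotProduct_comm, hxε]
end

section
/- Let C be an N × K real matrix, Q an N × K real matrix with orthonormal columns (QᵀQ = I_K) whose column space equals the column space of C, and x, y ∈ ℝ^N with x not in the column space of C. Suppose β ∈ ℝ, γ ∈ ℝ^K, ε ∈ ℝ^N satisfy y = xβ + Cγ + ε with Cᵀε = 0 and x·ε = 0 (the OLS fit of y on x and C). Then x·x − (Qᵀx)·(Qᵀx) > 0 and β = (x·y − (Qᵀx)·(Qᵀy)) / (x·x − (Qᵀx)·(Qᵀx)). -/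
open Matrix

/-- Closed form for the transient coefficient (Lemma 1 of the paper):
`β = (x·y − Qᵀx·Qᵀy) / (x·x − Qᵀx·Qᵀx)`, with positive denominator. -/
theorem scan_beta_formula {N K : ℕ} (C Q : Matrix (Fin N) (Fin K) ℝ)
    (hQ : Qᵀ * Q = 1)
    (hspan : LinearMap.range C.mulVecLin = LinearMap.range Q.mulVecLin)
    (x y : Fin N → ℝ) (hx : x ∉ LinearMap.range C.mulVecLin)
    (β : ℝ) (γ : Fin K → ℝ) (ε : Fin N → ℝ)
    (hmodel : y = β • x + C.mulVec γ + ε)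
    (hCε : Cᵀ.mulVec ε = 0) (hxε : x ⬝ᵥ ε = 0) :
    0 < x ⬝ᵥ x - (Qᵀ.mulVec x) ⬝ᵥ (Qᵀ.mulVec x) ∧
    β = (x ⬝ᵥ y - (Qᵀ.mulVec x) ⬝ᵥ (Qᵀ.mulVec y)) /
        (x ⬝ᵥ x - (Qᵀ.mulVec x) ⬝ᵥ (Qᵀ.mulVec x)) := by
  have key : ∀ (M : Matrix (Fin N) (Fin K) ℝ) (u : Fin N → ℝ) (w : Fin K → ℝ),
      u ⬝ᵥ (M *ᵥ w) = (Mᵀ *ᵥ u) ⬝ᵥ w := by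
    intro M u w
    rw [dotProduct_mulVec, mulVec_transpose]
  have hQQ : ∀ w : Fin K → ℝ, Qᵀ *ᵥ (Q *ᵥ w) = w := by
    intro w
    rw [mulVec_mulVec, hQ, one_mulVec]
  have hQε : Qᵀ *ᵥ ε = 0 := by
    have hmem : Q.mulVecLin (Qᵀ *ᵥ ε) ∈ LinearMap.range C.mulVecLin := by
      rw [hspan]; exact ⟨_, rfl⟩
    obtain ⟨v, hv⟩ := hmem
    simp only [mulVecLin_apply] at hv
    have h := key Q ε (Qᵀ *ᵥ ε)
    rw [← hv, key C, hCε, zero_dotProduct] at h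
    exact dotProduct_self_eq_zero.mp h.symm
  have hmem : C.mulVecLin γ ∈ LinearMap.range Q.mulVecLin := by
    rw [← hspan]; exact ⟨_, rfl⟩
  obtain ⟨w, hw⟩ := hmem
  simp only [mulVecLin_apply] at hw
  have hpos : 0 < x ⬝ᵥ x - (Qᵀ *ᵥ x) ⬝ᵥ (Qᵀ *ᵥ x) := by
    have hr : x - Q *ᵥ (Qᵀ *ᵥ x) ≠ 0 := by
      intro h0
      apply hx
      rw [hspan]
      exact ⟨Qᵀ *ᵥ x, (sub_eq_zero.mp h0).symm⟩
    have h1 : (x - Q *ᵥ (Qᵀ *ᵥ x)) ⬝ᵥ (x - Q *ᵥ (Qᵀ *ᵥ x))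
        = x ⬝ᵥ x - (Qᵀ *ᵥ x) ⬝ᵥ (Qᵀ *ᵥ x) := by
      rw [dotProduct_sub, key, mulVec_sub, hQQ, sub_self, zero_dotProduct, sub_zero,
        sub_dotProduct, dotProduct_comm (Q *ᵥ _) x, key]
    rw [← h1]
    have h2 : 0 ≤ (x - Q *ᵥ (Qᵀ *ᵥ x)) ⬝ᵥ (x - Q *ᵥ (Qᵀ *ᵥ x)) :=
      Finset.sum_nonneg fun i _ => mul_self_nonneg _
    exact lt_of_le_of_ne h2 fun h => hr (dotProduct_self_eq_zero.mp h.symm)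
  refine ⟨hpos, ?_⟩
  rw [eq_div_iff hpos.ne', hmodel, ← hw]
  simp only [mulVec_add, mulVec_smul, hQQ, hQε, dotProduct_add, dotProduct_smul, hxε, key,
    smul_eq_mul, add_zero]
  ring
end

section
/- Let C be an N × K real matrix, Q an N × K real matrix with orthonormal columns (QᵀQ = I_K) whose column space equals the column space of C, and x, y ∈ ℝ^N with x not in the column space of C. Suppose β ∈ ℝ, γ ∈ ℝ^K, ε ∈ ℝ^N satisfy y = xβ + Cγ + ε with Cᵀε = 0 and x·ε = 0 (the OLS fit of y on x and C). Then ε·ε = (y·y − (Qᵀy)·(Qᵀy)) − β² · (x·x − (Qᵀx)·(Qᵀx)); equivalently, ε·ε / (x·x − (Qᵀx)·(Qᵀx)) = (y·y − (Qᵀy)·(Qᵀy)) / (x·x − (Qᵀx)·(Qᵀx)) − β². -/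
open Matrix

/-- Closed form for the residual sum of squares (Lemma 1 of the paper):
`ε·ε = (y·y − Qᵀy·Qᵀy) − β²(x·x − Qᵀx·Qᵀx)`, and the equivalent divided form. -/
theorem scan_sigma_formula {N K : ℕ} (C Q : Matrix (Fin N) (Fin K) ℝ)
    (hQ : Qᵀ * Q = 1)
    (hspan : LinearMap.range C.mulVecLin = LinearMap.range Q.mulVecLin)
    (x y : Fin N → ℝ) (hx : x ∉ LinearMap.range C.mulVecLin)
    (β : ℝ) (γ : Fin K → ℝ) (ε : Fin N → ℝ)
    (hmodel : y = β • x + C.mulVec γ + ε)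
    (hCε : Cᵀ.mulVec ε = 0) (hxε : x ⬝ᵥ ε = 0) :
    ε ⬝ᵥ ε = (y ⬝ᵥ y - (Qᵀ.mulVec y) ⬝ᵥ (Qᵀ.mulVec y))
        - β ^ 2 * (x ⬝ᵥ x - (Qᵀ.mulVec x) ⬝ᵥ (Qᵀ.mulVec x)) ∧
    ε ⬝ᵥ ε / (x ⬝ᵥ x - (Qᵀ.mulVec x) ⬝ᵥ (Qᵀ.mulVec x)) =
      (y ⬝ᵥ y - (Qᵀ.mulVec y) ⬝ᵥ (Qᵀ.mulVec y)) /
        (x ⬝ᵥ x - (Qᵀ.mulVec x) ⬝ᵥ (Qᵀ.mulVec x)) - β ^ 2 := by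
  have adj : ∀ (A : Matrix (Fin N) (Fin K) ℝ) (u : Fin N → ℝ) (d : Fin K → ℝ),
      u ⬝ᵥ A *ᵥ d = Aᵀ *ᵥ u ⬝ᵥ d := by
    intro A u d
    rw [dotProduct_mulVec, mulVec_transpose]
  have hQQ : ∀ d : Fin K → ℝ, Qᵀ *ᵥ (Q *ᵥ d) = d := by
    intro d
    rw [mulVec_mulVec, hQ, one_mulVec]
  have hQε : Qᵀ *ᵥ ε = 0 := by
    apply dotProduct_eq_zero _ 
    intro w
    have hw : Q *ᵥ w ∈ LinearMap.range C.mulVecLin := by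
      rw [hspan]; exact ⟨w, rfl⟩
    obtain ⟨v, hv⟩ := hw
    rw [mulVecLin_apply] at hv
    rw [← adj, ← hv, adj, hCε, zero_dotProduct]
  obtain ⟨δ, hδ⟩ : ∃ δ, Q *ᵥ δ = C *ᵥ γ := by
    have h : C *ᵥ γ ∈ LinearMap.range Q.mulVecLin := by
      rw [← hspan]; exact ⟨γ, rfl⟩
    exact h
  have hD : x ⬝ᵥ x - (Qᵀ *ᵥ x) ⬝ᵥ (Qᵀ *ᵥ x) ≠ 0 := by
    intro h0
    apply hx
    rw [hspan]
    refine ⟨Qᵀ *ᵥ x, ?_⟩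
    rw [mulVecLin_apply]
    have : x - Q *ᵥ (Qᵀ *ᵥ x) = 0 := by
      rw [← dotProduct_self_eq_zero]
      rw [sub_dotProduct, dotProduct_sub, dotProduct_sub, adj, adj, hQQ,
        dotProduct_comm (Q *ᵥ Qᵀ *ᵥ x) x, adj]
      linarith
    exact (sub_eq_zero.mp this).symm
  have h1 : ε ⬝ᵥ ε = (y ⬝ᵥ y - (Qᵀ *ᵥ y) ⬝ᵥ (Qᵀ *ᵥ y))
        - β ^ 2 * (x ⬝ᵥ x - (Qᵀ *ᵥ x) ⬝ᵥ (Qᵀ *ᵥ x)) := by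
    have hy : Qᵀ *ᵥ y = β • (Qᵀ *ᵥ x) + δ := by
      rw [hmodel, ← hδ, mulVec_add, mulVec_add, mulVec_smul, hQQ, hQε, add_zero]
    have e1 : ε ⬝ᵥ Q *ᵥ δ = 0 := by rw [adj, hQε, zero_dotProduct]
    have e2 : Q *ᵥ δ ⬝ᵥ ε = 0 := by rw [dotProduct_comm, e1]
    have e3 : ε ⬝ᵥ x = 0 := by rw [dotProduct_comm, hxε]
    have e4 : Q *ᵥ δ ⬝ᵥ Q *ᵥ δ = δ ⬝ᵥ δ := by rw [adj, hQQ]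
    have e5 : x ⬝ᵥ Q *ᵥ δ = Qᵀ *ᵥ x ⬝ᵥ δ := adj _ _ _
    have e6 : Q *ᵥ δ ⬝ᵥ x = Qᵀ *ᵥ x ⬝ᵥ δ := by rw [dotProduct_comm, e5]
    rw [hy, hmodel, ← hδ]
    simp only [add_dotProduct, dotProduct_add, smul_dotProduct, dotProduct_smul, smul_eq_mul,
      e1, e2, e3, e4, e5, e6, hxε, dotProduct_comm δ (Qᵀ *ᵥ x)]
    ring
  refine ⟨h1, ?_⟩
  rw [h1, sub_div, mul_div_cancel_right₀ _ hD]
end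

section
/- Let C_a, C_b, C_c be real matrices with N_a, N_b, N_c rows respectively and K columns each, with QR decompositions C_p = Q_p R_p where Q_pᵀQ_p = I_K (p ∈ {a,b,c}). Let S be the (3K) × K matrix obtained by vertically stacking R_a, R_b, R_c, and suppose S = Q′R with Q′ᵀQ′ = I_K. Let C be the (N_a+N_b+N_c) × K matrix obtained by vertically stacking C_a, C_b, C_c. Then C = QR where Q is the product of the block-diagonal matrix diag(Q_a, Q_b, Q_c) with Q′, and this Q satisfies QᵀQ = I_K. In particular, the QR decompositions of C and of the stack of the R_p share the same R factor. -/
open Matrix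

/-- Lemma 2 (TSQR identity): if `C_p = Q_p R_p` are QR decompositions and the
vertical stack of the `R_p` has QR decomposition `Q′R`, then
`C = (diag(Q_a,Q_b,Q_c) Q′) R` is a QR decomposition of the vertical stack `C`
of the `C_p`; in particular the QR decompositions of `C` and of the stack of
the `R_p` share the same `R` factor. -/
theorem tsqr_same_R {Na Nb Nc K : ℕ}
    (Ca : Matrix (Fin Na) (Fin K) ℝ) (Cb : Matrix (Fin Nb) (Fin K) ℝ)
    (Cc : Matrix (Fin Nc) (Fin K) ℝ)
    (Qa : Matrix (Fin Na) (Fin K) ℝ) (Qb : Matrix (Fin Nb) (Fin K) ℝ)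
    (Qc : Matrix (Fin Nc) (Fin K) ℝ)
    (Ra Rb Rc R : Matrix (Fin K) (Fin K) ℝ)
    (Q' : Matrix (Fin K ⊕ (Fin K ⊕ Fin K)) (Fin K) ℝ)
    (hCa : Ca = Qa * Ra) (hQa : Qaᵀ * Qa = 1) (hRa : Ra.BlockTriangular id)
    (hCb : Cb = Qb * Rb) (hQb : Qbᵀ * Qb = 1) (hRb : Rb.BlockTriangular id)
    (hCc : Cc = Qc * Rc) (hQc : Qcᵀ * Qc = 1) (hRc : Rc.BlockTriangular id)
    (hS : Matrix.fromRows Ra (Matrix.fromRows Rb Rc) = Q' * R)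
    (hQ' : Q'ᵀ * Q' = 1) (hR : R.BlockTriangular id) :
    Matrix.fromRows Ca (Matrix.fromRows Cb Cc) =
      (Matrix.fromBlocks Qa 0 0 (Matrix.fromBlocks Qb 0 0 Qc) * Q') * R ∧
    (Matrix.fromBlocks Qa 0 0 (Matrix.fromBlocks Qb 0 0 Qc) * Q')ᵀ *
      (Matrix.fromBlocks Qa 0 0 (Matrix.fromBlocks Qb 0 0 Qc) * Q') = 1 := by
  have hD : (Matrix.fromBlocks Qa 0 0 (Matrix.fromBlocks Qb 0 0 Qc))ᵀ *
      Matrix.fromBlocks Qa 0 0 (Matrix.fromBlocks Qb 0 0 Qc) = 1 := by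
    simp [Matrix.fromBlocks_transpose, Matrix.fromBlocks_multiply, hQa, hQb, hQc]
  constructor
  · rw [Matrix.mul_assoc, ← hS, hCa, hCb, hCc]
    simp [Matrix.fromBlocks_mul_fromRows]
  · rw [Matrix.transpose_mul, Matrix.mul_assoc, ← Matrix.mul_assoc _ _ Q', hD,
      Matrix.one_mul, hQ']
end

section
/- Let C be a fixed N × K real matrix with CᵀC invertible, let γ ∈ ℝ^K be fixed, and let ε = (ε₁, …, ε_N) be real-valued square-integrable random variables on a probability space that are pairwise uncorrelated with E[εᵢ] = 0 and Var(εᵢ) = τ² for all i. Define y = Cγ + ε and γ̂ = (CᵀC)⁻¹Cᵀy. Then E[‖y − Cγ̂‖²] = (N − K)τ². Consequently, τ̂² = ‖y − Cγ̂‖²/(N − K) is an unbiased estimator of τ². -/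
open Matrix MeasureTheory

/-- Unbiasedness of the residual variance estimator: under the homoskedastic
uncorrelated-noise model, `E[‖y − Cγ̂‖²] = (N − K)τ²`; consequently
`τ̂² = ‖y − Cγ̂‖²/(N − K)` is an unbiased estimator of `τ²`. -/
theorem ols_tau_unbiased {N K : ℕ} (hKN : K ≤ N) (C : Matrix (Fin N) (Fin K) ℝ)
    (hC : IsUnit (Cᵀ * C)) (γ : Fin K → ℝ) (τ : ℝ)
    {Ω : Type*} [MeasurableSpace Ω] (μ : Measure Ω) [IsProbabilityMeasure μ]
    (ε : Fin N → Ω → ℝ)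
    (hεL2 : ∀ i, MemLp (ε i) 2 μ)
    (hεmean : ∀ i, ∫ ω, ε i ω ∂μ = 0)
    (hεvar : ∀ i, ∫ ω, ε i ω ^ 2 ∂μ = τ ^ 2)
    (hεuncor : ∀ i j, i ≠ j → ∫ ω, ε i ω * ε j ω ∂μ = 0)
    (y : Ω → Fin N → ℝ) (hy : ∀ ω, y ω = C.mulVec γ + fun i => ε i ω)
    (γhat : Ω → Fin K → ℝ)
    (hγhat : ∀ ω, γhat ω = (Cᵀ * C)⁻¹.mulVec (Cᵀ.mulVec (y ω))) :
    ∫ ω, (y ω - C.mulVec (γhat ω)) ⬝ᵥ (y ω - C.mulVec (γhat ω)) ∂μ =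
      ((N : ℝ) - K) * τ ^ 2 ∧
    (K < N →
      ∫ ω, (y ω - C.mulVec (γhat ω)) ⬝ᵥ (y ω - C.mulVec (γhat ω)) / ((N : ℝ) - K) ∂μ =
        τ ^ 2) := by
  have hdet : IsUnit (Cᵀ * C).det := (Matrix.isUnit_iff_isUnit_det _).1 hC
  set G := (Cᵀ * C)⁻¹ with hG
  have hG1 : G * (Cᵀ * C) = 1 := Matrix.nonsing_inv_mul _ hdet
  have hGT : Gᵀ = G := by
    rw [hG, Matrix.transpose_nonsing_inv, Matrix.transpose_mul, Matrix.transpose_transpose]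
  set M : Matrix (Fin N) (Fin N) ℝ := 1 - C * G * Cᵀ with hM
  have hMC : M * C = 0 := by
    rw [hM, Matrix.sub_mul, Matrix.one_mul, Matrix.mul_assoc, Matrix.mul_assoc, hG1,
      Matrix.mul_one, sub_self]
  have hMT : Mᵀ = M := by
    rw [hM, Matrix.transpose_sub, Matrix.transpose_one, Matrix.transpose_mul,
      Matrix.transpose_mul, Matrix.transpose_transpose, hGT, Matrix.mul_assoc]
  have hMM : M * M = M := by
    have : M * M = M * 1 - M * C * (G * Cᵀ) := by
      conv_lhs => rw [hM]
      rw [← hM]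
      conv_lhs => enter [2]; rw [hM]
      rw [Matrix.mul_sub, Matrix.mul_assoc C, Matrix.mul_assoc M]
    rw [this, hMC, Matrix.zero_mul, sub_zero, Matrix.mul_one]
  have htr : M.trace = (N : ℝ) - K := by
    rw [hM, Matrix.trace_sub, Matrix.trace_one, Matrix.mul_assoc, Matrix.trace_mul_comm,
      Matrix.mul_assoc, hG1, Matrix.trace_one, Fintype.card_fin, Fintype.card_fin]
  have hres : ∀ ω, y ω - C.mulVec (γhat ω) = M.mulVec (fun i => ε i ω) := by
    intro ω
    have h1 : y ω - C.mulVec (γhat ω) = M.mulVec (y ω) := by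
      rw [hγhat, hM, Matrix.sub_mulVec, Matrix.one_mulVec, Matrix.mulVec_mulVec,
        Matrix.mulVec_mulVec, Matrix.mul_assoc]
    rw [h1, hy, Matrix.mulVec_add, Matrix.mulVec_mulVec, hMC, Matrix.zero_mulVec, zero_add]
  have hq : ∀ ω, (y ω - C.mulVec (γhat ω)) ⬝ᵥ (y ω - C.mulVec (γhat ω)) =
      ∑ i, ∑ j, M i j * (ε i ω * ε j ω) := by
    intro ω
    rw [hres, Matrix.dotProduct_mulVec, Matrix.vecMul_mulVec, hMT, hMM, ← Matrix.dotProduct_mulVec]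
    simp only [dotProduct, Matrix.mulVec, Finset.mul_sum]
    refine Finset.sum_congr rfl fun i _ => Finset.sum_congr rfl fun j _ => ?_
    ring
  have hint : ∀ i j, Integrable (fun ω => M i j * (ε i ω * ε j ω)) μ := fun i j =>
    ((hεL2 i).integrable_mul (hεL2 j)).const_mul _
  have main : ∫ ω, (y ω - C.mulVec (γhat ω)) ⬝ᵥ (y ω - C.mulVec (γhat ω)) ∂μ =
      ((N : ℝ) - K) * τ ^ 2 := by
    simp only [hq]
    rw [integral_finsetSum _ fun i _ => integrable_finsetSum _ fun j _ => hint i j, ← htr,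
      Matrix.trace, Finset.sum_mul]
    refine Finset.sum_congr rfl fun i _ => ?_
    rw [integral_finsetSum _ fun j _ => hint i j, Finset.sum_eq_single i]
    · rw [integral_const_mul, Matrix.diag_apply, ← hεvar i]
      simp only [pow_two]
    · intro j _ hj
      rw [integral_const_mul, hεuncor i j hj.symm, mul_zero]
    · simp
  refine ⟨main, fun hlt => ?_⟩
  have hne : (N : ℝ) - K ≠ 0 := by
    have : (K : ℝ) < N := by exact_mod_cast hlt
    linarith
  rw [integral_div, main, mul_div_cancel_left₀ _ hne]
end
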